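/- arXiv:2508.01792 — 4 statements merged into one kernel-verified Lean document; each statement's English description precedes it below -/
import Mathlib

section
/- Let X be a simplicial complex of rank n ≥ 0. Then for every x ∈ X and every y ∈ α□_X(x), the poset β□_X(y) ∩ α□_X(x) (with the induced order) is a (dim(x) − dim(y) − 2)-surface. -/
namespace PCMPaper

variable {α : Type*} [PartialOrder α]

/-- The set of elements of `X` strictly below `h` (α□_X(h)). -/
def alphaS (X : Set α) (h : α) : Set α := {x ∈ X | x < h}

/-- The set of elements of `X` strictly above `h` (β□_X(h)). -/
def betaS (X : Set α) (h : α) : Set α := {x ∈ X | h < x}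

/-- The (strict) neighborhood θ□_X(h) = α□_X(h) ∪ β□_X(h). -/
def thetaS (X : Set α) (h : α) : Set α := alphaS X h ∪ betaS X h

/-- The rank of `h` in the poset `X`: the maximal length of a strictly increasing
chain in `X` ending at `h`.  (It equals 0 when α□_X(h) = ∅ and
`max_{x ∈ α□_X(h)} rank X x + 1` otherwise, for finite `X`.) -/
noncomputable def rank (X : Set α) (h : α) : ℕ :=
  sSup {n : ℕ | ∃ c : Fin (n + 1) → α, StrictMono c ∧ (∀ i, c i ∈ X) ∧ c (Fin.last n) = h}

open scoped Classical in
/-- The rank of the poset `X`: maximal rank of its elements, `-1` if empty. -/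
noncomputable def rankSet (X : Set α) : ℤ :=
  if X = ∅ then -1 else ((sSup (rank X '' X) : ℕ) : ℤ)

/-- One step of a path in `X`: two distinct comparable elements of `X`. -/
def rel (X : Set α) (x y : α) : Prop :=
  x ∈ X ∧ y ∈ X ∧ x ≠ y ∧ (x < y ∨ y < x)

/-- `X` is (path-)connected: any two elements are joined by a path in `X`. -/
def IsConnected (X : Set α) : Prop :=
  ∀ x ∈ X, ∀ y ∈ X, Relation.ReflTransGen (rel X) x y

/-- `IsSurfaceAux (k + 1) X` means that `X` is a (discrete) `k`-surface. -/
def IsSurfaceAux : ℕ → Set α → Prop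
  | 0, X => X = ∅
  | 1, X => ∃ x y : α, x ≠ y ∧ ¬ x < y ∧ ¬ y < x ∧ X = {x, y}
  | (n + 2), X => X.Nonempty ∧ IsConnected X ∧ ∀ h ∈ X, IsSurfaceAux (n + 1) (thetaS X h)

/-- `X` is a discrete `k`-surface (`k : ℤ`, `k ≥ -1`). -/
def IsSurface (k : ℤ) (X : Set α) : Prop :=
  ∃ n : ℕ, (n : ℤ) = k + 1 ∧ IsSurfaceAux n X

/-- The border ΔX of a poset `X` of rank `n`:
elements whose neighborhood is not an `(n-1)`-surface. -/
def border (X : Set α) : Set α :=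
  {h ∈ X | ¬ IsSurface (rankSet X - 1) (thetaS X h)}

/-- The interior of `X`. -/
def interior' (X : Set α) : Set α := X \ border X

/-- `IsPCMAux (n + 1) X` means that `X` is an `n`-PCM. -/
def IsPCMAux : ℕ → Set α → Prop
  | 0, X => X = ∅
  | 1, X => ∃ x : α, X = {x}
  | (n + 2), X => rankSet X = ((n : ℤ) + 1) ∧ IsConnected X ∧ border X ≠ ∅ ∧
      ∀ h ∈ X, (h ∈ border X → IsPCMAux (n + 1) (thetaS X h)) ∧
               (h ∉ border X → IsSurfaceAux (n + 1) (thetaS X h))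

/-- `X` is an `k`-PCM (`k : ℤ`, `k ≥ -1`). -/
def IsPCM (k : ℤ) (X : Set α) : Prop :=
  ∃ n : ℕ, (n : ℤ) = k + 1 ∧ IsPCMAux n X

/-- Fuel-indexed coherence. -/
def IsCoherentAux : ℕ → Set α → Prop
  | 0, X => X = ∅
  | (n + 1), X => X = ∅ ∨
      ∀ h ∈ X, rankSet (thetaS X h) = rankSet X - 1 ∧ IsCoherentAux n (thetaS X h)

/-- `X` is a coherent poset. -/
def IsCoherent (X : Set α) : Prop := ∃ n : ℕ, IsCoherentAux n X

/-- `X` is a separated union of `(m-1)`-surfaces: a union of `(m-1)`-surfaces such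
that no element of one of them is comparable to an element of another one. -/
def IsSeparatedUnionOfSurfacesAux (m : ℕ) (X : Set α) : Prop :=
  ∃ P : Set (Set α), P.Nonempty ∧ X = ⋃₀ P ∧ (∀ S ∈ P, IsSurfaceAux m S) ∧
    ∀ S ∈ P, ∀ T ∈ P, S ≠ T → ∀ x ∈ S, ∀ y ∈ T, ¬ x ≤ y ∧ ¬ y ≤ x

/-- `IsSmoothPCMAux (n + 1) X` means that `X` is a smooth `n`-PCM. -/
def IsSmoothPCMAux : ℕ → Set α → Prop
  | 0, X => X = ∅
  | 1, X => ∃ x : α, X = {x}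
  | (n + 2), X => rankSet X = ((n : ℤ) + 1) ∧ IsConnected X ∧ border X ≠ ∅ ∧
      IsSeparatedUnionOfSurfacesAux (n + 1) (border X) ∧
      ∀ h ∈ X, IsSurfaceAux (n + 1) (thetaS X h) ∨ IsSmoothPCMAux (n + 1) (thetaS X h)

/-- `X` is a smooth `k`-PCM (`k : ℤ`, `k ≥ -1`). -/
def IsSmoothPCM (k : ℤ) (X : Set α) : Prop :=
  ∃ n : ℕ, (n : ℤ) = k + 1 ∧ IsSmoothPCMAux n X

/-- A simplicial complex: a finite family of nonempty finite sets, closed under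
taking nonempty subsets and under nonempty intersections. -/
def IsSimplicialComplex {V : Type*} [DecidableEq V] (X : Set (Finset V)) : Prop :=
  X.Finite ∧ (∀ h ∈ X, h.Nonempty) ∧
  (∀ h ∈ X, ∀ h' : Finset V, h'.Nonempty → h' ⊆ h → h' ∈ X) ∧
  (∀ h ∈ X, ∀ h' ∈ X, (h ∩ h').Nonempty → h ∩ h' ∈ X)

/-- The dimension of a simplex. -/
def dim {V : Type*} (h : Finset V) : ℤ := (h.card : ℤ) - 1

/-- The link of a simplex `h` in a family of simplices `S`. -/
def link {V : Type*} [DecidableEq V] (h : Finset V) (S : Set (Finset V)) : Set (Finset V) :=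
  {h' ∈ S | h ∩ h' = ∅ ∧ h ∪ h' ∈ S}

/-- `X` is pure of rank `n`: every simplex is contained in an `n`-dimensional one. -/
def Pure {V : Type*} (X : Set (Finset V)) (n : ℤ) : Prop :=
  ∀ h ∈ X, ∃ g ∈ X, h ⊆ g ∧ dim g = n

/-- Any two `n`-simplices of `X` are joined by a path in `X` all of whose elements
are simplices of dimension `n - 1` or `n` (i.e. `X` is `(n-1)`-connected). -/
def NConnected {V : Type*} (X : Set (Finset V)) (n : ℤ) : Prop :=
  ∀ a ∈ X, dim a = n → ∀ b ∈ X, dim b = n →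
    Relation.ReflTransGen (rel {h | h ∈ X ∧ (dim h = n - 1 ∨ dim h = n)}) a b

/-- `X` is a pseudomanifold of rank `n`. -/
def IsPseudomanifold {V : Type*} [DecidableEq V] (X : Set (Finset V)) (n : ℤ) : Prop :=
  IsSimplicialComplex X ∧ rankSet X = n ∧
  ((n = 0 ∧ ∃ v : V, X = {({v} : Finset V)}) ∨
   (1 ≤ n ∧ Pure X n ∧
    (∀ h ∈ X, dim h = n - 1 →
      Set.ncard {g | g ∈ X ∧ h ⊆ g ∧ dim g = n} ∈ ({1, 2} : Set ℕ)) ∧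
    NConnected X n))

/-- `X` is a normal pseudomanifold of rank `n`: a pseudomanifold such that the link
of every simplex of dimension at most `n - 2` is a pseudomanifold. -/
def IsNormalPseudomanifold {V : Type*} [DecidableEq V] (X : Set (Finset V)) (n : ℤ) : Prop :=
  IsPseudomanifold X n ∧
  ∀ h ∈ X, dim h ≤ n - 2 → IsPseudomanifold (link h X) (n - dim h - 1)


theorem reflTransGen_rel_of_le {X : Set α} {a b : α} (ha : a ∈ X) (hb : b ∈ X) (h : a ≤ b) :
    Relation.ReflTransGen (rel X) a b ∧ Relation.ReflTransGen (rel X) b a := by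
  rcases h.eq_or_lt with rfl | hlt
  · exact ⟨.refl, .refl⟩
  · exact ⟨.single ⟨ha, hb, hlt.ne, .inl hlt⟩, .single ⟨hb, ha, hlt.ne', .inr hlt⟩⟩

theorem IsSurfaceAux.nonempty {p : ℕ} {A : Set α} (h : IsSurfaceAux (p + 1) A) :
    A.Nonempty := by
  cases p with
  | zero =>
    obtain ⟨x, y, -, -, -, rfl⟩ := h
    exact ⟨x, .inl rfl⟩
  | succ p => exact h.1

theorem IsSurfaceAux.thetaS {p : ℕ} {A : Set α} (h : IsSurfaceAux (p + 1) A) {a : α}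
    (ha : a ∈ A) : IsSurfaceAux p (thetaS A a) := by
  cases p with
  | zero =>
    obtain ⟨x, y, -, hxy, hyx, rfl⟩ := h
    refine Set.eq_empty_of_forall_notMem fun z hz => ?_
    rcases hz with ⟨rfl | rfl, hz⟩ | ⟨rfl | rfl, hz⟩ <;> rcases ha with rfl | rfl <;>
      first | exact lt_irrefl _ hz | exact hxy hz | exact hyx hz
  | succ p => exact h.2.2 a ha

theorem thetaS_union (A B : Set α) (a : α) :
    thetaS (A ∪ B) a = thetaS A a ∪ thetaS B a := by
  ext z
  simp only [thetaS, alphaS, betaS, Set.mem_union, Set.mem_ofPred_eq]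
  tauto

/-- The ordinal sum of two surfaces is a surface. -/
theorem IsSurfaceAux.union {p q : ℕ} {A B : Set α} (hA : IsSurfaceAux p A)
    (hB : IsSurfaceAux q B) (hAB : ∀ a ∈ A, ∀ b ∈ B, a < b) :
    IsSurfaceAux (p + q) (A ∪ B) := by
  induction hn : p + q generalizing p q A B with
  | zero =>
    obtain ⟨rfl, rfl⟩ : p = 0 ∧ q = 0 := by omega
    change A = ∅ at hA
    change B = ∅ at hB
    simp [hA, hB, IsSurfaceAux]
  | succ n ih =>
    rcases p with _ | p
    · obtain rfl : q = n + 1 := by omega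
      change A = ∅ at hA
      rwa [hA, Set.empty_union]
    rcases q with _ | q
    · obtain rfl : p = n := by omega
      change B = ∅ at hB
      rwa [hB, Set.union_empty]
    obtain ⟨n, rfl⟩ : ∃ m, n = m + 1 := ⟨n - 1, by omega⟩
    obtain ⟨a₀, ha₀⟩ := hA.nonempty
    obtain ⟨b₀, hb₀⟩ := hB.nonempty
    have key : ∀ a ∈ A, ∀ b ∈ B, Relation.ReflTransGen (rel (A ∪ B)) a b ∧
        Relation.ReflTransGen (rel (A ∪ B)) b a := fun a ha b hb =>
      reflTransGen_rel_of_le (.inl ha) (.inr hb) (hAB a ha b hb).le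
    refine ⟨⟨a₀, .inl ha₀⟩, ?_, ?_⟩
    · rintro x (hx | hx) y (hy | hy)
      · exact (key x hx b₀ hb₀).1.trans (key y hy b₀ hb₀).2
      · exact (key x hx y hy).1
      · exact (key y hy x hx).2
      · exact (key a₀ ha₀ x hx).2.trans (key a₀ ha₀ y hy).1
    · rintro h (hh | hh)
      · have hBh : PCMPaper.thetaS B h = B := by
          ext z
          simp only [PCMPaper.thetaS, alphaS, betaS, Set.mem_union, Set.mem_ofPred_eq]
          exact ⟨by tauto, fun hz => .inr ⟨hz, hAB h hh z hz⟩⟩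
        rw [thetaS_union, hBh]
        refine ih (hA.thetaS hh) hB (fun a ha b hb => hAB a ?_ b hb) (by omega)
        exact ha.elim And.left And.left
      · have hAh : PCMPaper.thetaS A h = A := by
          ext z
          simp only [PCMPaper.thetaS, alphaS, betaS, Set.mem_union, Set.mem_ofPred_eq]
          exact ⟨by tauto, fun hz => .inl ⟨hz, hAB z hz h hh⟩⟩
        rw [thetaS_union, hAh]
        refine ih hA (hB.thetaS hh) (fun a ha b hb => hAB a ha b ?_) (by omega)
        exact hb.elim And.left And.left

theorem thetaS_Ioo {x y h : α} (hh : h ∈ Set.Ioo y x) :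
    thetaS (Set.Ioo y x) h = Set.Ioo y h ∪ Set.Ioo h x := by
  ext z
  constructor
  · rintro (⟨hz, hzh⟩ | ⟨hz, hzh⟩)
    · exact .inl ⟨hz.1, hzh⟩
    · exact .inr ⟨hzh, hz.2⟩
  · rintro (hz | hz)
    · exact .inl ⟨⟨hz.1, hz.2.trans hh.2⟩, hz.2⟩
    · exact .inr ⟨⟨hh.1.trans hz.1, hz.2⟩, hz.1⟩

/-- An open interval of height at least three in a lattice of finite sets is connected. -/
theorem isConnected_Ioo_finset {V : Type*} {x y : Finset V} (hc : y.card + 3 ≤ x.card) :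
    IsConnected (Set.Ioo y x) := by
  classical
  have mem {s : Finset V} (hys : y ⊂ s) (hsx : s ⊆ x) (hs : s.card ≤ y.card + 2) :
      s ∈ Set.Ioo y x :=
    ⟨hys, hsx.ssubset_of_ne (by rintro rfl; omega)⟩
  have atom : ∀ z ∈ Set.Ioo y x, ∃ a ∈ x, a ∉ y ∧ insert a y ≤ z := by
    rintro z ⟨hyz, hzx⟩
    obtain ⟨a, haz, hay⟩ := Finset.exists_of_ssubset hyz
    exact ⟨a, hzx.le haz, hay, Finset.insert_subset haz hyz.le⟩
  intro z hz w hw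
  have hyx : y ⊆ x := (hz.1.trans hz.2).le
  obtain ⟨a, hax, hay, haz⟩ := atom z hz
  obtain ⟨b, hbx, hby, hbw⟩ := atom w hw
  have ha : insert a y ∈ Set.Ioo y x := mem (Finset.ssubset_insert hay)
    (Finset.insert_subset hax hyx) ((Finset.card_insert_le a y).trans (by omega))
  have hb : insert b y ∈ Set.Ioo y x := mem (Finset.ssubset_insert hby)
    (Finset.insert_subset hbx hyx) ((Finset.card_insert_le b y).trans (by omega))
  have hab : insert a (insert b y) ∈ Set.Ioo y x :=
    mem ((Finset.ssubset_insert hby).trans_subset (Finset.subset_insert _ _))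
      (Finset.insert_subset hax (Finset.insert_subset hbx hyx))
      ((Finset.card_insert_le a _).trans (by grw [Finset.card_insert_le b y]))
  exact (reflTransGen_rel_of_le ha hz haz).2.trans <|
    (reflTransGen_rel_of_le ha hab
      (Finset.insert_subset_insert a (Finset.subset_insert b y))).1.trans <|
    (reflTransGen_rel_of_le hb hab (Finset.subset_insert a _)).2.trans
      (reflTransGen_rel_of_le hb hw hbw).1

/-- An open interval in a lattice of finite sets is a surface. -/
theorem isSurfaceAux_Ioo_finset {V : Type*} {x y : Finset V} (hyx : y ⊂ x) {n : ℕ}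
    (hn : x.card = y.card + n + 1) : IsSurfaceAux n (Set.Ioo y x) := by
  classical
  induction n using Nat.strong_induction_on generalizing x y with
  | _ n ih =>
  match n with
  | 0 =>
    refine Set.eq_empty_of_forall_notMem fun z hz => ?_
    have h₁ := Finset.card_lt_card hz.1
    have h₂ := Finset.card_lt_card hz.2
    omega
  | 1 =>
    have hcard : (x \ y).card = 2 := by
      rw [Finset.card_sdiff_of_subset hyx.subset]; omega
    obtain ⟨a, b, hab, hxy⟩ := Finset.card_eq_two.mp hcard
    have hsd : ∀ c, c ∈ x ∧ c ∉ y ↔ c = a ∨ c = b := fun c => by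
      rw [← Finset.mem_sdiff, hxy]; simp
    obtain ⟨hax, hay⟩ := (hsd a).2 (.inl rfl)
    obtain ⟨hbx, hby⟩ := (hsd b).2 (.inr rfl)
    have hca := Finset.card_insert_of_notMem hay
    have hcb := Finset.card_insert_of_notMem hby
    refine ⟨insert a y, insert b y, ?_, fun h => ?_, fun h => ?_, ?_⟩
    · intro h
      have : a ∈ insert b y := h ▸ Finset.mem_insert_self a y
      simp [hab, hay] at this
    · have := Finset.card_lt_card h; omega
    · have := Finset.card_lt_card h; omega
    ext z
    constructor
    · rintro ⟨hyz, hzx⟩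
      have h₁ := Finset.card_lt_card hyz
      have h₂ := Finset.card_lt_card hzx
      obtain ⟨c, hcz, hcy⟩ := Finset.exists_of_ssubset hyz
      have hc := Finset.card_insert_of_notMem hcy
      have hz : insert c y = z :=
        Finset.eq_of_subset_of_card_le (Finset.insert_subset hcz hyz.le) (by omega)
      rcases (hsd c).1 ⟨hzx.le hcz, hcy⟩ with rfl | rfl
      · exact .inl hz.symm
      · exact .inr hz.symm
    · rintro (rfl | rfl)
      · exact ⟨Finset.ssubset_insert hay, (Finset.insert_subset hax hyx.subset).ssubset_of_ne
          (by rintro rfl; omega)⟩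
      · exact ⟨Finset.ssubset_insert hby, (Finset.insert_subset hbx hyx.subset).ssubset_of_ne
          (by rintro rfl; omega)⟩
  | m + 2 =>
    refine ⟨?_, isConnected_Ioo_finset (by omega), fun h hh => ?_⟩
    · obtain ⟨a, hax, hay⟩ := Finset.exists_of_ssubset hyx
      have hca := Finset.card_insert_of_notMem hay
      exact ⟨insert a y, Finset.ssubset_insert hay,
        (Finset.insert_subset hax hyx.subset).ssubset_of_ne (by rintro rfl; omega)⟩
    · have h₁ := Finset.card_lt_card hh.1
      have h₂ := Finset.card_lt_card hh.2
      rw [thetaS_Ioo hh, show m + 1 = (h.card - y.card - 1) + (x.card - h.card - 1) by omega]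
      exact (ih _ (by omega) hh.1 (by omega)).union (ih _ (by omega) hh.2 (by omega))
        fun a ha b hb => ha.2.trans hb.1

/-- In a simplicial complex `X` of rank `n ≥ 0`, for every `x ∈ X` and
every `y ∈ α□_X(x)`, the poset `β□_X(y) ∩ α□_X(x)` is a `(dim x - dim y - 2)`-surface. -/
theorem statement_0 {V : Type*} [DecidableEq V] (X : Set (Finset V)) (n : ℤ)
    (hsc : IsSimplicialComplex X) (hrk : rankSet X = n) (hn : 0 ≤ n)
    (x : Finset V) (hx : x ∈ X) (y : Finset V) (hy : y ∈ alphaS X x) :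
    IsSurface (dim x - dim y - 2) (betaS X y ∩ alphaS X x) := by
  have hyx : y ⊂ x := hy.2
  have hset : betaS X y ∩ alphaS X x = Set.Ioo y x := by
    ext z
    refine ⟨fun hz => ⟨hz.1.2, hz.2.2⟩, fun hz => ?_⟩
    have hzX : z ∈ X := hsc.2.2.1 x hx z ((hsc.2.1 y hy.1).mono hz.1.le) hz.2.le
    exact ⟨⟨hzX, hz.1⟩, hzX, hz.2⟩
  have hcard := Finset.card_lt_card hyx
  rw [hset]
  exact ⟨x.card - y.card - 1, by simp only [dim]; omega,
    isSurfaceAux_Ioo_finset hyx (by omega)⟩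

end PCMPaper
end

section
/- Every poset X which is an n-PCM with n ≥ 0 is pure: every element of X is less than or equal to some element of rank n in X. -/
namespace PCMPaper

variable {α : Type*} [PartialOrder α]

/-- `IsGraded m X` means that, recursively, `X` is empty if `m = 0`, and otherwise is nonempty
with every neighborhood graded of length `m - 1`. -/
def IsGraded : ℕ → Set α → Prop
  | 0, X => X = ∅
  | (m + 1), X => X.Nonempty ∧ ∀ h ∈ X, IsGraded m (thetaS X h)

theorem mem_thetaS {X : Set α} {h x : α} : x ∈ thetaS X h ↔ x ∈ X ∧ (x < h ∨ h < x) := by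
  simp only [thetaS, alphaS, betaS, Set.mem_union, Set.mem_ofPred_eq]
  tauto

theorem thetaS_eq_empty {X : Set α} {h : α} (hX : ∀ x ∈ X, ¬ x < h ∧ ¬ h < x) :
    thetaS X h = ∅ := by
  ext x
  simp only [mem_thetaS, Set.mem_empty_iff_false, iff_false]
  rintro ⟨hx, hlt⟩
  have := hX x hx
  tauto

theorem IsSurfaceAux.isGraded : ∀ {m : ℕ} {X : Set α}, IsSurfaceAux m X → IsGraded m X
  | 0, _, hX => hX
  | 1, X, hX => by
    obtain ⟨x, y, -, hxy, hyx, rfl⟩ := hX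
    refine ⟨⟨x, by simp⟩, fun h hh => thetaS_eq_empty fun z hz => ?_⟩
    rcases hh with rfl | rfl <;> rcases hz with rfl | rfl <;> simp [*]
  | (_ + 2), _, hX => ⟨hX.1, fun h hh => (hX.2.2 h hh).isGraded⟩

theorem IsPCMAux.isGraded : ∀ {m : ℕ} {X : Set α}, IsPCMAux m X → IsGraded m X
  | 0, _, hX => hX
  | 1, X, hX => by
    obtain ⟨x, rfl⟩ := hX
    refine ⟨⟨x, rfl⟩, fun h hh => thetaS_eq_empty fun z hz => ?_⟩
    obtain rfl : h = x := hh
    obtain rfl : z = h := hz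
    simp
  | (m + 2), X, hX => by
    obtain ⟨-, -, hborder, hX⟩ := hX
    refine ⟨(Set.nonempty_iff_ne_empty.2 hborder).mono fun _ hx => hx.1, fun h hh => ?_⟩
    by_cases hb : h ∈ border X
    · exact ((hX h hh).1 hb).isGraded
    · exact ((hX h hh).2 hb).isGraded

open scoped Classical in
theorem erase_subset_thetaS {X : Set α} {S : Finset α} (hS : IsChain (· ≤ ·) (S : Set α))
    (hSX : (S : Set α) ⊆ X) {h : α} (hh : h ∈ S) : ((S.erase h : Finset α) : Set α) ⊆ thetaS X h := by
  intro x hx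
  obtain ⟨hxh, hxS⟩ := Finset.mem_erase.1 (Finset.mem_coe.1 hx)
  refine mem_thetaS.2 ⟨hSX hxS, ?_⟩
  rcases hS hxS hh hxh with hle | hle
  · exact Or.inl (lt_of_le_of_ne hle hxh)
  · exact Or.inr (lt_of_le_of_ne hle hxh.symm)

open scoped Classical in
theorem IsGraded.card_le {m : ℕ} {X : Set α} (hX : IsGraded m X) {S : Finset α}
    (hS : IsChain (· ≤ ·) (S : Set α)) (hSX : (S : Set α) ⊆ X) : S.card ≤ m := by
  induction m generalizing X S with
  | zero =>
    obtain rfl : X = ∅ := hX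
    simpa using hSX
  | succ m ih =>
    rcases S.eq_empty_or_nonempty with rfl | ⟨h, hh⟩
    · simp
    · have := ih (hX.2 h (hSX hh)) (hS.mono (by simp)) (erase_subset_thetaS hS hSX hh)
      rw [Finset.card_erase_of_mem hh] at this
      omega

open scoped Classical in
theorem IsGraded.exists_chain_card_eq {m : ℕ} {X : Set α} (hX : IsGraded m X) {S : Finset α}
    (hS : IsChain (· ≤ ·) (S : Set α)) (hSX : (S : Set α) ⊆ X) :
    ∃ T : Finset α, S ⊆ T ∧ IsChain (· ≤ ·) (T : Set α) ∧ (T : Set α) ⊆ X ∧ T.card = m := by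
  induction m generalizing X S with
  | zero =>
    obtain rfl : X = ∅ := hX
    exact ⟨S, subset_rfl, hS, hSX, by simpa using hSX⟩
  | succ m ih =>
    obtain ⟨h, hhX, hsub⟩ : ∃ h ∈ X, ((S.erase h : Finset α) : Set α) ⊆ thetaS X h := by
      rcases S.eq_empty_or_nonempty with rfl | ⟨h, hh⟩
      · obtain ⟨h, hh⟩ := hX.1
        exact ⟨h, hh, by simp⟩
      · exact ⟨h, hSX hh, erase_subset_thetaS hS hSX hh⟩
    obtain ⟨T, hST, hT, hTX, rfl⟩ := ih (hX.2 h hhX) (hS.mono (by simp)) hsub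
    refine ⟨insert h T, ?_, ?_, ?_, Finset.card_insert_of_notMem fun hh => ?_⟩
    · rwa [Finset.subset_insert_iff]
    · rw [Finset.coe_insert]
      refine hT.insert fun b hb _ => ?_
      exact (mem_thetaS.1 (hTX hb)).2.symm.imp le_of_lt le_of_lt
    · rw [Finset.coe_insert]
      exact Set.insert_subset hhX fun x hx => (mem_thetaS.1 (hTX hx)).1
    · simpa using (mem_thetaS.1 (hTX hh)).2

theorem exists_strictMono_of_isChain {T : Finset α} (hT : IsChain (· ≤ ·) (T : Set α)) {k : ℕ}
    (hk : T.card = k) : ∃ c : Fin k → α, StrictMono c ∧ Set.range c = T := by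
  classical
  let _ : LinearOrder T :=
    { (inferInstance : PartialOrder T) with
      le_total := fun a b => hT.total a.2 b.2
      toDecidableLE := Classical.decRel _ }
  let e := monoEquivOfFin T ((Fintype.card_coe T).trans hk)
  refine ⟨fun i => (e i : α), fun i j hij => e.strictMono hij, ?_⟩
  ext x
  constructor
  · rintro ⟨i, rfl⟩
    exact (e i).2
  · intro hx
    exact ⟨e.symm ⟨x, hx⟩, by simp⟩

theorem IsGraded.rank_eq {n : ℕ} {X : Set α} (hX : IsGraded (n + 1) X) {c : Fin (n + 1) → α}
    (hc : StrictMono c) (hcX : ∀ i, c i ∈ X) : rank X (c (Fin.last n)) = n := by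
  classical
  refine IsGreatest.csSup_eq ⟨⟨c, hc, hcX, rfl⟩, ?_⟩
  rintro k ⟨d, hd, hdX, -⟩
  have := hX.card_le (S := Finset.univ.image d)
    (by simpa using hd.monotone.isChain_range) (by simpa [Set.range_subset_iff] using hdX)
  rw [Finset.card_image_of_injective _ hd.injective, Finset.card_fin] at this
  omega

/-- Every (finite) poset which is an `n`-PCM with `n ≥ 0` is pure:
every element is below some element of rank `n`. -/
theorem statement_1 {α : Type*} [PartialOrder α] (X : Set α) (hfin : X.Finite)
    (n : ℤ) (hn : 0 ≤ n) (hpcm : IsPCM n X) :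
    ∀ h ∈ X, ∃ g ∈ X, h ≤ g ∧ (rank X g : ℤ) = n := by
  obtain ⟨m, hm, hX⟩ := hpcm
  lift n to ℕ using hn
  obtain rfl : m = n + 1 := by omega
  have hX := hX.isGraded
  intro h hh
  obtain ⟨T, hST, hT, hTX, hcard⟩ :=
    hX.exists_chain_card_eq (S := {h}) (by simp) (by simpa using hh)
  obtain ⟨c, hc, hcT⟩ := exists_strictMono_of_isChain hT hcard
  have hcX : ∀ i, c i ∈ X := fun i => hTX (hcT ▸ Set.mem_range_self i)
  obtain ⟨i, rfl⟩ : h ∈ Set.range c := hcT ▸ Finset.singleton_subset_iff.1 hST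
  exact ⟨c (Fin.last n), hcX _, hc.monotone (Fin.le_last i), mod_cast hX.rank_eq hc hcX⟩

end PCMPaper
end

section
/- If X is an n-PCM with n ≥ 0, then for every h ∈ X the poset α□_X(h) is either a (rk(h,X)−1)-PCM or a (rk(h,X)−1)-surface. -/
namespace PCMPaper

variable {α : Type*} [PartialOrder α]

/-- `HasHeight S n`: the longest chains of `S` have exactly `n` elements. -/
def HasHeight (S : Set α) (n : ℕ) : Prop :=
  IsGreatest {m : ℕ | ∃ t : Finset α, (t : Set α) ⊆ S ∧ IsChain (· ≤ ·) (t : Set α) ∧ t.card = m} n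

lemma exists_strictMono_of_isChain_s3 (m : ℕ) : ∀ (t : Finset α) (h : α),
    IsChain (· ≤ ·) (t : Set α) → t.card = m → (∀ x ∈ t, x < h) →
    ∃ c : Fin (m + 1) → α, StrictMono c ∧ (∀ i, c i = h ∨ c i ∈ t) ∧ c (Fin.last m) = h := by
  classical
  induction m with
  | zero =>
    intro t h _ _ _
    exact ⟨fun _ => h, fun i j hij => absurd hij (by omega), fun _ => Or.inl rfl, rfl⟩
  | succ m ih =>
    intro t h ht hc hlt
    obtain ⟨x, hx⟩ := t.exists_maximal (Finset.card_pos.mp (by omega))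
    have hxt : x ∈ t := hx.1
    obtain ⟨c, hmono, hmem, hlast⟩ := ih (t.erase x) x
      (ht.mono (by simp)) (by rw [Finset.card_erase_of_mem hxt]; omega) (by
        intro y hy
        obtain ⟨hne, hyt⟩ := Finset.mem_erase.mp hy
        rcases ht hyt hxt hne with hle | hle
        · exact lt_of_le_of_ne hle hne
        · exact absurd (le_antisymm (hx.2 hyt hle) hle) hne)
    have hct : ∀ i, c i ∈ t := fun i => by
      rcases hmem i with hi | hi
      · exact hi ▸ hxt
      · exact Finset.mem_of_mem_erase hi
    refine ⟨Fin.snoc (α := fun _ => α) c h, ?_, ?_, by simp⟩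
    · rw [Fin.strictMono_iff_lt_succ]
      intro i
      induction i using Fin.lastCases with
      | last => simpa using hlt _ (hct _)
      | cast j =>
        rw [← Fin.castSucc_succ, Fin.snoc_castSucc, Fin.snoc_castSucc]
        exact hmono Fin.castSucc_lt_succ
    · intro i
      induction i using Fin.lastCases with
      | last => simp
      | cast j => simpa using Or.inr (hct j)

lemma exists_strictMono_iff_exists_isChain {X : Set α} {h : α} (hX : h ∈ X) (m : ℕ) :
    (∃ c : Fin (m + 1) → α, StrictMono c ∧ (∀ i, c i ∈ X) ∧ c (Fin.last m) = h) ↔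
      ∃ t : Finset α, (t : Set α) ⊆ alphaS X h ∧ IsChain (· ≤ ·) (t : Set α) ∧ t.card = m := by
  classical
  constructor
  · rintro ⟨c, hmono, hmem, rfl⟩
    refine ⟨Finset.univ.image (c ∘ Fin.castSucc), ?_, ?_, ?_⟩
    · intro x hx
      simp only [Finset.coe_image, Finset.coe_univ, Set.image_univ, Set.mem_range] at hx
      obtain ⟨i, rfl⟩ := hx
      exact ⟨hmem _, hmono (Fin.castSucc_lt_last i)⟩
    · simp only [Finset.coe_image, Finset.coe_univ, Set.image_univ]
      exact (hmono.comp Fin.strictMono_castSucc).monotone.isChain_range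
    · rw [Finset.card_image_of_injective _ (hmono.comp Fin.strictMono_castSucc).injective,
        Finset.card_univ, Fintype.card_fin]
  · rintro ⟨t, hsub, ht, hc⟩
    obtain ⟨c, hmono, hmem, hlast⟩ :=
      exists_strictMono_of_isChain_s3 m t h ht hc fun x hx => (hsub hx).2
    refine ⟨c, hmono, fun i => ?_, hlast⟩
    rcases hmem i with hi | hi
    · exact hi ▸ hX
    · exact (hsub hi).1

lemma HasHeight.rank_eq {X : Set α} {h : α} (hX : h ∈ X) {k : ℕ}
    (hk : HasHeight (alphaS X h) k) : rank X h = k := by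
  simp only [rank, exists_strictMono_iff_exists_isChain hX]
  exact hk.csSup_eq

lemma exists_hasHeight {S : Set α} (hS : S.Finite) : ∃ n, HasHeight S n := by
  refine ⟨_, Nat.sSup_mem ⟨0, ∅, by simp⟩ ?_, fun m hm => le_csSup ?_ hm⟩ <;>
  · refine ⟨hS.toFinset.card, ?_⟩
    rintro m ⟨t, hsub, -, rfl⟩
    exact Finset.card_le_card fun x hx => hS.mem_toFinset.mpr (hsub hx)

lemma hasHeight_alphaS_rank {X : Set α} (hfin : X.Finite) {h : α} (hX : h ∈ X) :
    HasHeight (alphaS X h) (rank X h) := by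
  obtain ⟨k, hk⟩ := exists_hasHeight (hfin.subset (Set.sep_subset X (· < h)))
  exact (HasHeight.rank_eq hX hk).symm ▸ hk

lemma hasHeight_empty : HasHeight (∅ : Set α) 0 := by
  refine ⟨⟨∅, by simp⟩, ?_⟩
  rintro m ⟨t, hsub, -, rfl⟩
  simp [Finset.coe_eq_empty.mp (Set.subset_empty_iff.mp hsub)]

lemma hasHeight_singleton (x : α) : HasHeight {x} 1 := by
  refine ⟨⟨{x}, by simp⟩, ?_⟩
  rintro m ⟨t, hsub, -, rfl⟩
  exact Finset.card_le_card (t := {x}) (by simpa [← Finset.coe_subset] using hsub)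

lemma hasHeight_pair {x y : α} (hxy : ¬ x < y) (hyx : ¬ y < x) : HasHeight {x, y} 1 := by
  refine ⟨⟨{x}, by simp⟩, ?_⟩
  rintro m ⟨t, hsub, ht, rfl⟩
  refine Finset.card_le_one.mpr fun a ha b hb => ?_
  by_contra hab
  have hcmp := ht ha hb hab
  have hlt : a < b ∨ b < a :=
    hcmp.imp (fun h => lt_of_le_of_ne h hab) fun h => lt_of_le_of_ne h (Ne.symm hab)
  rcases hsub ha with rfl | rfl <;> rcases hsub hb with rfl | rfl <;> tauto

lemma hasHeight_of_rankSet {X : Set α} (hfin : X.Finite) {n : ℕ} (hr : rankSet X = n) :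
    HasHeight X (n + 1) := by
  classical
  have hne : X ≠ ∅ := by
    rintro rfl
    simp only [rankSet, if_true] at hr
    omega
  simp only [rankSet, if_neg hne, Nat.cast_inj] at hr
  have hbdd : BddAbove (rank X '' X) := (hfin.image _).bddAbove
  constructor
  · obtain ⟨h, hX, hh⟩ :=
      Nat.sSup_mem ((Set.nonempty_iff_ne_empty.mpr hne).image (rank X)) hbdd
    obtain ⟨t, hsub, ht, hc⟩ := (hasHeight_alphaS_rank hfin hX).1
    refine ⟨insert h t, ?_, ?_, ?_⟩
    · rw [Finset.coe_insert]
      exact Set.insert_subset hX fun x hx => (hsub hx).1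
    · rw [Finset.coe_insert]
      exact ht.insert fun b hb _ => Or.inr (hsub hb).2.le
    · rw [Finset.card_insert_of_notMem fun hm => lt_irrefl _ (hsub hm).2]
      omega
  · rintro m ⟨t, hsub, ht, rfl⟩
    rcases t.eq_empty_or_nonempty with rfl | htne
    · simp
    obtain ⟨h, hmax⟩ := t.exists_maximal htne
    have hht : h ∈ t := hmax.1
    have hle := (hasHeight_alphaS_rank hfin (hsub hht)).2
      ⟨t.erase h, fun x hx => ?_, ht.mono (by simp), rfl⟩
    · have := le_csSup hbdd (Set.mem_image_of_mem (rank X) (hsub hht))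
      have := Finset.card_erase_add_one hht
      omega
    · obtain ⟨hne, hxt⟩ := Finset.mem_erase.mp hx
      refine ⟨hsub hxt, lt_of_le_of_ne ?_ hne⟩
      rcases ht hxt hht hne with hle | hle
      · exact hle
      · exact hmax.2 hxt hle

lemma IsSurfaceAux.hasHeight (n : ℕ) : ∀ {S : Set α}, IsSurfaceAux n S → HasHeight S n := by
  classical
  induction n using Nat.strong_induction_on with
  | _ n ih =>
    intro S hS
    match n, hS with
    | 0, hS =>
      obtain rfl : S = ∅ := hS
      exact hasHeight_empty
    | 1, ⟨x, y, _, hxy, hyx, hS⟩ => exact hS ▸ hasHeight_pair hxy hyx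
    | n + 2, ⟨⟨h, hh⟩, _, hS⟩ =>
      constructor
      · obtain ⟨t, hsub, ht, hc⟩ := (ih (n + 1) (by omega) (hS h hh)).1
        refine ⟨insert h t, ?_, ?_, ?_⟩
        · rw [Finset.coe_insert]
          exact Set.insert_subset hh fun x hx => (hsub hx).elim And.left And.left
        · rw [Finset.coe_insert]
          exact ht.insert fun b hb _ =>
            (hsub hb).elim (fun hlt => Or.inr hlt.2.le) fun hlt => Or.inl hlt.2.le
        · rw [Finset.card_insert_of_notMem
            fun hm => (hsub hm).elim (fun hlt => lt_irrefl _ hlt.2) fun hlt => lt_irrefl _ hlt.2]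
          omega
      · rintro m ⟨t, hsub, ht, rfl⟩
        rcases t.eq_empty_or_nonempty with rfl | ⟨x, hxt⟩
        · simp
        have hle := (ih (n + 1) (by omega) (hS x (hsub hxt))).2
          ⟨t.erase x, fun y hy => ?_, ht.mono (by simp), rfl⟩
        · have := Finset.card_erase_add_one hxt
          omega
        · obtain ⟨hne, hyt⟩ := Finset.mem_erase.mp hy
          rcases ht hyt hxt hne with hle | hle
          · exact Or.inl ⟨hsub hyt, lt_of_le_of_ne hle hne⟩
          · exact Or.inr ⟨hsub hyt, lt_of_le_of_ne hle hne.symm⟩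

lemma IsPCMAux.hasHeight {n : ℕ} {S : Set α} (hfin : S.Finite) (hS : IsPCMAux n S) :
    HasHeight S n := by
  match n, hS with
  | 0, hS =>
    obtain rfl : S = ∅ := hS
    exact hasHeight_empty
  | 1, ⟨x, hS⟩ => exact hS ▸ hasHeight_singleton x
  | n + 2, ⟨hr, _⟩ => exact hasHeight_of_rankSet hfin (by simpa using hr)

/-- In an ordered join of `A` below a nonempty `B`, the neighborhood of a point of `B` is the
ordered join of `A` and the neighborhood of that point in `B`. -/
lemma thetaS_union_of_mem_right {A B : Set α} (hAB : ∀ a ∈ A, ∀ b ∈ B, a < b) {b : α}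
    (hb : b ∈ B) : thetaS (A ∪ B) b = A ∪ thetaS B b := by
  ext x
  simp only [thetaS, alphaS, betaS, Set.mem_union, Set.mem_ofPred_eq]
  have h₁ := fun hx : x ∈ A => hAB x hx b hb
  tauto

/-- The lower part of an ordered join that is a surface or a PCM is a surface or a PCM. -/
lemma exists_isPCMAux_or_isSurfaceAux_left (n : ℕ) : ∀ {A B : Set α},
    (∀ a ∈ A, ∀ b ∈ B, a < b) → IsPCMAux n (A ∪ B) ∨ IsSurfaceAux n (A ∪ B) →
    ∃ k, IsPCMAux k A ∨ IsSurfaceAux k A := by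
  induction n using Nat.strong_induction_on with
  | _ n ih =>
    intro A B hAB hP
    rcases B.eq_empty_or_nonempty with rfl | ⟨b, hb⟩
    · rw [Set.union_empty] at hP
      exact ⟨n, hP⟩
    rcases A.eq_empty_or_nonempty with rfl | ⟨a, ha⟩
    · exact ⟨0, Or.inl rfl⟩
    have haU : a ∈ A ∪ B := Or.inl ha
    have hbU : b ∈ A ∪ B := Or.inr hb
    have hab := hAB a ha b hb
    match n, hP with
    | 0, hP =>
      have hU : A ∪ B = ∅ := hP.elim id id
      simp [hU] at haU
    | 1, Or.inl ⟨x, hU⟩ =>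
      rw [hU] at haU hbU
      exact absurd (haU.trans hbU.symm) hab.ne
    | 1, Or.inr ⟨x, y, _, hxy, hyx, hU⟩ =>
      rw [hU] at haU hbU
      rcases haU with rfl | rfl <;> rcases hbU with rfl | rfl <;> simp_all
    | n + 2, hP =>
      refine ih (n + 1) (by omega) (B := thetaS B b)
        (fun x hx y hy => hAB x hx y (hy.elim And.left And.left)) ?_
      rw [← thetaS_union_of_mem_right hAB hb]
      rcases hP with ⟨_, _, _, hP⟩ | ⟨_, _, hP⟩
      · by_cases hbd : b ∈ border (A ∪ B)
        · exact Or.inl ((hP b hbU).1 hbd)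
        · exact Or.inr ((hP b hbU).2 hbd)
      · exact Or.inr (hP b hbU)

lemma IsPCMAux.exists_isPCMAux_or_isSurfaceAux_alphaS {n : ℕ} {X : Set α} (hX : IsPCMAux n X)
    {h : α} (hh : h ∈ X) : ∃ k, IsPCMAux k (alphaS X h) ∨ IsSurfaceAux k (alphaS X h) := by
  match n, hX with
  | 0, hX =>
    obtain rfl : X = ∅ := hX
    exact absurd hh (Set.notMem_empty h)
  | 1, ⟨x, hX⟩ =>
    subst hX
    obtain rfl : h = x := hh
    exact ⟨0, Or.inl (Set.eq_empty_of_forall_notMem fun y hy => hy.2.ne hy.1)⟩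
  | n + 2, ⟨_, _, _, hX⟩ =>
    refine exists_isPCMAux_or_isSurfaceAux_left (n + 1) (B := betaS X h)
      (fun a ha b hb => ha.2.trans hb.2) ?_
    by_cases hbd : h ∈ border X
    · exact Or.inl ((hX h hh).1 hbd)
    · exact Or.inr ((hX h hh).2 hbd)

/-- If `X` is an `n`-PCM with `n ≥ 0`, then for every `h ∈ X`, the poset
`α□_X(h)` is a `(rk(h,X) - 1)`-PCM or a `(rk(h,X) - 1)`-surface. -/
theorem statement_3 {α : Type*} [PartialOrder α] (X : Set α) (hfin : X.Finite)
    (n : ℤ) (hn : 0 ≤ n) (hpcm : IsPCM n X) :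
    ∀ h ∈ X, IsPCM ((rank X h : ℤ) - 1) (alphaS X h) ∨
             IsSurface ((rank X h : ℤ) - 1) (alphaS X h) := by
  intro h hh
  obtain ⟨m, -, hX⟩ := hpcm
  have hαfin : (alphaS X h).Finite := hfin.subset (Set.sep_subset X (· < h))
  obtain ⟨k, hk⟩ := hX.exists_isPCMAux_or_isSurfaceAux_alphaS hh
  have hrank : rank X h = k :=
    HasHeight.rank_eq hh (hk.elim (IsPCMAux.hasHeight hαfin) (IsSurfaceAux.hasHeight k))
  exact hk.imp (fun hk => ⟨k, by omega, hk⟩) fun hk => ⟨k, by omega, hk⟩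

end PCMPaper
end

section
/- If X is an n-PCM with n ≥ 0, then for every h ∈ X the poset β□_X(h) is either a (n − rk(h,X) − 1)-PCM or a (n − rk(h,X) − 1)-surface. -/
namespace PCMPaper

variable {α : Type*} [PartialOrder α]

section ChainRank

/-- `c` is a strictly increasing chain of length `n` in `X` ending at `h`. -/
def IsChainTo (X : Set α) (h : α) (n : ℕ) (c : Fin (n + 1) → α) : Prop :=
  StrictMono c ∧ (∀ i, c i ∈ X) ∧ c (Fin.last n) = h

lemma isChainTo_const {X : Set α} {h : α} (hX : h ∈ X) : IsChainTo X h 0 (fun _ => h) :=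
  ⟨fun i j hij => by omega, fun _ => hX, rfl⟩

lemma bddAbove_chain_lengths {X : Set α} (hfin : X.Finite) (h : α) :
    BddAbove {n : ℕ | ∃ c, IsChainTo X h n c} := by
  refine ⟨X.ncard, ?_⟩
  rintro n ⟨c, hc, hX, -⟩
  have hle : (Set.range c).ncard ≤ X.ncard :=
    Set.ncard_le_ncard (Set.range_subset_iff.2 hX) hfin
  rw [Set.ncard_range_of_injective hc.injective, Nat.card_fin] at hle
  omega

lemma IsChainTo.le_rank {X : Set α} (hfin : X.Finite) {h : α} {n : ℕ} {c : Fin (n + 1) → α}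
    (hc : IsChainTo X h n c) : n ≤ rank X h :=
  le_csSup (bddAbove_chain_lengths hfin h) ⟨c, hc⟩

lemma exists_isChainTo_rank {X : Set α} (hfin : X.Finite) {h : α} (hX : h ∈ X) :
    ∃ c, IsChainTo X h (rank X h) c :=
  Nat.sSup_mem (s := {n : ℕ | ∃ c, IsChainTo X h n c})
    ⟨0, fun _ => h, isChainTo_const hX⟩
    (bddAbove_chain_lengths hfin h)

lemma IsChainTo.cons {X : Set α} {h x : α} {n : ℕ} {c : Fin (n + 1) → α}
    (hc : IsChainTo X h n c) (hx : x ∈ X) (hlt : x < c 0) :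
    IsChainTo X h (n + 1) (Fin.cons x c) := by
  refine ⟨?_, fun i => ?_, ?_⟩
  · refine Fin.strictMono_iff_lt_succ.2 fun i => ?_
    refine Fin.cases ?_ (fun j => ?_) i
    · simpa using hlt
    · rw [← Fin.succ_castSucc, Fin.cons_succ, Fin.cons_succ]
      exact hc.1 Fin.castSucc_lt_succ
  · refine Fin.cases ?_ (fun j => ?_) i
    · simpa using hx
    · simpa using hc.2.1 j
  · rw [← Fin.succ_last, Fin.cons_succ, hc.2.2]

/-- A chain realizing the rank of `h` starts at a minimal element of `X`. -/
lemma IsChainTo.alphaS_eq_empty {X : Set α} (hfin : X.Finite) {h : α}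
    {c : Fin (rank X h + 1) → α} (hc : IsChainTo X h (rank X h) c) :
    alphaS X (c 0) = ∅ := by
  refine Set.eq_empty_of_forall_notMem fun x hx => ?_
  have := (hc.cons hx.1 hx.2).le_rank hfin
  omega

lemma exists_minimal_rank_betaS {X : Set α} (hfin : X.Finite) {h : α} (hX : h ∈ X) {r : ℕ}
    (hr : rank X h = r + 1) :
    ∃ x ∈ X, alphaS X x = ∅ ∧ x < h ∧ rank (betaS X x) h = r := by
  obtain ⟨c, hc⟩ := exists_isChainTo_rank hfin hX
  have hmin := hc.alphaS_eq_empty hfin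
  revert c
  rw [hr]
  intro c hc hmin
  have hlt : c 0 < h := hc.2.2 ▸ hc.1 (Fin.last_pos)
  have hfin' : (betaS X (c 0)).Finite := hfin.subset fun _ hx => hx.1
  refine ⟨c 0, hc.2.1 0, hmin, hlt, le_antisymm ?_ ?_⟩
  · obtain ⟨d, hd⟩ := exists_isChainTo_rank hfin' (h := h) ⟨hX, hlt⟩
    have hd' : IsChainTo X h _ d := ⟨hd.1, fun i => (hd.2.1 i).1, hd.2.2⟩
    have := (hd'.cons (hc.2.1 0) (hd.2.1 0).2).le_rank hfin
    omega
  · have htail : IsChainTo (betaS X (c 0)) h r (fun i => c i.succ) :=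
      ⟨fun i j hij => hc.1 (Fin.succ_lt_succ_iff.2 hij),
        fun i => ⟨hc.2.1 _, hc.1 (Fin.succ_pos i)⟩, hc.2.2⟩
    exact htail.le_rank hfin'

end ChainRank

lemma thetaS_eq_betaS {X : Set α} {h : α} (hα : alphaS X h = ∅) : thetaS X h = betaS X h := by
  rw [thetaS, hα, Set.empty_union]

lemma betaS_betaS {X : Set α} {x h : α} (hlt : x < h) : betaS (betaS X x) h = betaS X h := by
  ext y
  exact ⟨fun hy => ⟨hy.1.1, hy.2⟩, fun hy => ⟨⟨hy.1, hlt.trans hy.2⟩, hy.2⟩⟩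

/-- Every neighborhood in a PCM or surface is a PCM or surface of one rank less. -/
lemma isPCMAux_or_isSurfaceAux_thetaS {m : ℕ} {X : Set α}
    (hX : IsPCMAux (m + 1) X ∨ IsSurfaceAux (m + 1) X) {h : α} (hh : h ∈ X) :
    IsPCMAux m (thetaS X h) ∨ IsSurfaceAux m (thetaS X h) := by
  cases m with
  | zero =>
    refine Or.inl (Set.eq_empty_of_forall_notMem fun y hy => ?_)
    rcases hX with ⟨a, rfl⟩ | ⟨a, b, -, hab, hba, rfl⟩
    · obtain rfl : h = a := hh
      rcases hy with ⟨rfl, hlt⟩ | ⟨rfl, hlt⟩ <;> exact lt_irrefl _ hlt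
    · rcases hh with rfl | rfl <;> rcases hy with ⟨rfl | rfl, hlt⟩ | ⟨rfl | rfl, hlt⟩ <;>
        first | exact lt_irrefl _ hlt | exact hab hlt | exact hba hlt
  | succ m =>
    rcases hX with ⟨-, -, -, hX⟩ | ⟨-, -, hX⟩
    · by_cases hb : h ∈ border X
      · exact Or.inl ((hX h hh).1 hb)
      · exact Or.inr ((hX h hh).2 hb)
    · exact Or.inr (hX h hh)

lemma exists_isPCMAux_or_isSurfaceAux_betaS (m : ℕ) {X : Set α} (hfin : X.Finite)
    (hX : IsPCMAux m X ∨ IsSurfaceAux m X) {h : α} (hh : h ∈ X) :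
    ∃ k, k + rank X h + 1 = m ∧ (IsPCMAux k (betaS X h) ∨ IsSurfaceAux k (betaS X h)) := by
  induction m generalizing X with
  | zero =>
    have : X = ∅ := hX.elim id id
    simp [this] at hh
  | succ m ih =>
    rcases hr : rank X h with _ | r
    · have hmin : alphaS X h = ∅ := Set.eq_empty_of_forall_notMem fun x hx => by
        have := ((isChainTo_const hh).cons hx.1 hx.2).le_rank hfin
        omega
      refine ⟨m, rfl, ?_⟩
      rw [← thetaS_eq_betaS hmin]
      exact isPCMAux_or_isSurfaceAux_thetaS hX hh
    · obtain ⟨x, hx, hmin, hlt, hrank⟩ := exists_minimal_rank_betaS hfin hh hr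
      have hθ := isPCMAux_or_isSurfaceAux_thetaS hX hx
      rw [thetaS_eq_betaS hmin] at hθ
      obtain ⟨k, hk, hβ⟩ := ih (hfin.subset fun _ hy => hy.1) hθ ⟨hh, hlt⟩
      rw [betaS_betaS hlt] at hβ
      exact ⟨k, by omega, hβ⟩

/-- If `X` is an `n`-PCM with `n ≥ 0`, then for every `h ∈ X`, the poset
`β□_X(h)` is a `(n - rk(h,X) - 1)`-PCM or a `(n - rk(h,X) - 1)`-surface. -/
theorem statement_4 {α : Type*} [PartialOrder α] (X : Set α) (hfin : X.Finite)
    (n : ℤ) (hn : 0 ≤ n) (hpcm : IsPCM n X) :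
    ∀ h ∈ X, IsPCM (n - (rank X h : ℤ) - 1) (betaS X h) ∨
             IsSurface (n - (rank X h : ℤ) - 1) (betaS X h) := by
  intro h hh
  obtain ⟨m, hm, hX⟩ := hpcm
  obtain ⟨k, hk, hβ⟩ := exists_isPCMAux_or_isSurfaceAux_betaS m hfin (Or.inl hX) hh
  have hkn : (k : ℤ) = n - (rank X h : ℤ) - 1 + 1 := by omega
  exact hβ.imp (fun hβ => ⟨k, hkn, hβ⟩) (fun hβ => ⟨k, hkn, hβ⟩)

end PCMPaper
end
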